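/- Let Ω ⊂ ℝ^n be an open bounded set, let 𝓔 be a Cheeger N-cluster of Ω, fix i ∈ {1,…,N}, and set M_i = ∪_{j≠i} 𝓔(j). Then M_i has distributional mean curvature at most H_N(Ω) in Ω with radius r_0 = n/(4 H_N(Ω)): for every ball B_r ⊂⊂ Ω with r < r_0 and every set of finite perimeter L ⊆ M_i with M_i \ L ⊂⊂ B_r, one has P(M_i;B_r) ≤ P(L;B_r) + H_N(Ω)|M_i \ L|. -/

import Mathlib

open MeasureTheory Set Metric Filter Bornology
open scoped ENNReal NNReal Topology RealInnerProductSpace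

noncomputable section

abbrev Euc (n : ℕ) := EuclideanSpace ℝ (Fin n)

/-- Divergence of a vector field on `ℝⁿ`. -/
def vdiv {n : ℕ} (T : Euc n → Euc n) (x : Euc n) : ℝ :=
  ∑ i : Fin n, ⟪fderiv ℝ T x (EuclideanSpace.single i 1), EuclideanSpace.single i 1⟫

/-- The relative (distributional) perimeter of `E` inside `A`: the supremum of
`∫_E div T` over smooth, compactly supported vector fields `T` with `tsupport T ⊆ A`
and `‖T‖ ≤ 1`. -/
def perimeterIn {n : ℕ} (E A : Set (Euc n)) : ℝ≥0∞ :=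
  ⨆ (T : Euc n → Euc n) (_ : ContDiff ℝ (⊤ : ℕ∞) T) (_ : HasCompactSupport T)
    (_ : tsupport T ⊆ A) (_ : ∀ x, ‖T x‖ ≤ 1),
    ENNReal.ofReal (∫ x in E, vdiv T x)

/-- The (distributional) perimeter of `E`. -/
def perimeter {n : ℕ} (E : Set (Euc n)) : ℝ≥0∞ := perimeterIn E univ

/-- `E` has locally finite perimeter. -/
def HasLocFinitePerimeter {n : ℕ} (E : Set (Euc n)) : Prop :=
  ∀ (x : Euc n) (r : ℝ), perimeterIn E (ball x r) < ⊤

/-- `ν` is the measure-theoretic outer unit normal of `E` at `x`: blow-ups of `E`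
at `x` converge in measure to the half space `{y : ⟪y - x, ν⟫ ≤ 0}`. -/
def blowsUpTo {n : ℕ} (E : Set (Euc n)) (x ν : Euc n) : Prop :=
  ‖ν‖ = 1 ∧
    Tendsto (fun r : ℝ =>
        volume (symmDiff E {y : Euc n | ⟪y - x, ν⟫ ≤ 0} ∩ ball x r) / ENNReal.ofReal (r ^ n))
      (𝓝[>] (0 : ℝ)) (𝓝 0)

/-- The reduced boundary `∂* E`. -/
def redBoundary {n : ℕ} (E : Set (Euc n)) : Set (Euc n) :=
  {x | ∃ ν, blowsUpTo E x ν}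

open Classical in
/-- The measure-theoretic outer unit normal `ν_E` (junk value `0` off `∂* E`). -/
def mtNormal {n : ℕ} (E : Set (Euc n)) (x : Euc n) : Euc n :=
  if h : ∃ ν, blowsUpTo E x ν then h.choose else 0

/-- An `N`-cluster contained in `Ω`: `N` Borel subsets of `Ω`, with positive and finite
volume, finite perimeter, pairwise disjoint up to Lebesgue measure zero. -/
structure NCluster (n N : ℕ) (Ω : Set (Euc n)) where
  cham : Fin N → Set (Euc n)
  measurableSet_cham : ∀ i, MeasurableSet (cham i)
  cham_subset : ∀ i, cham i ⊆ Ω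
  vol_pos : ∀ i, 0 < volume (cham i)
  vol_lt_top : ∀ i, volume (cham i) < ⊤
  perimeter_lt_top : ∀ i, perimeter (cham i) < ⊤
  ae_disjoint : ∀ i j, i ≠ j → volume (cham i ∩ cham j) = 0

/-- The functional `Σᵢ P(𝓔(i))/|𝓔(i)|`. -/
def clusterEnergy {n N : ℕ} {Ω : Set (Euc n)} (𝓔 : NCluster n N Ω) : ℝ≥0∞ :=
  ∑ i, perimeter (𝓔.cham i) / volume (𝓔.cham i)

/-- The `N`-Cheeger constant `H_N(Ω)`. -/
def NCheeger (n N : ℕ) (Ω : Set (Euc n)) : ℝ≥0∞ :=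
  ⨅ 𝓔 : NCluster n N Ω, clusterEnergy 𝓔

/-- A Cheeger `N`-cluster: a minimizer of `clusterEnergy`. -/
def IsCheegerNCluster {n N : ℕ} {Ω : Set (Euc n)} (𝓔 : NCluster n N Ω) : Prop :=
  clusterEnergy 𝓔 = NCheeger n N Ω

/-- The Cheeger constant `h(A)`. -/
def cheegerConst {n : ℕ} (A : Set (Euc n)) : ℝ≥0∞ :=
  ⨅ (E : Set (Euc n)) (_ : MeasurableSet E) (_ : E ⊆ A) (_ : 0 < volume E),
    perimeter E / volume E

/-- A Cheeger set of `A`. -/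
def IsCheegerSet {n : ℕ} (E A : Set (Euc n)) : Prop :=
  MeasurableSet E ∧ E ⊆ A ∧ 0 < volume E ∧ perimeter E / volume E = cheegerConst A

/-- `Ω` has `C¹` boundary: near each boundary point, `Ω` is the sublevel set of a `C¹`
function with non-vanishing differential. -/
def HasC1Boundary {n : ℕ} (Ω : Set (Euc n)) : Prop :=
  ∀ x ∈ frontier Ω, ∃ (U : Set (Euc n)) (f : Euc n → ℝ), IsOpen U ∧ x ∈ U ∧
    ContDiff ℝ 1 f ∧ (∀ y ∈ U, fderiv ℝ f y ≠ 0) ∧ Ω ∩ U = {y ∈ U | f y < 0}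

/-- The `n`-dimensional density of `E` at `x` exists and equals `d`. -/
def HasDensity {n : ℕ} (E : Set (Euc n)) (x : Euc n) (d : ℝ≥0∞) : Prop :=
  Tendsto (fun r : ℝ => volume (E ∩ ball x r) / volume (ball x r)) (𝓝[>] (0 : ℝ)) (𝓝 d)

/-- The external chamber `𝓔(0) = Ω \ ⋃ᵢ 𝓔(i)`. -/
def extChamber {n N : ℕ} {Ω : Set (Euc n)} (𝓔 : NCluster n N Ω) : Set (Euc n) :=
  Ω \ ⋃ i, 𝓔.cham i


/-- Admissible test fields. -/
def Adm {n : ℕ} (A : Set (Euc n)) (T : Euc n → Euc n) : Prop :=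
  ContDiff ℝ (⊤ : ℕ∞) T ∧ HasCompactSupport T ∧ tsupport T ⊆ A ∧ ∀ x, ‖T x‖ ≤ 1

lemma perimeterIn_eq {n : ℕ} (E A : Set (Euc n)) :
    perimeterIn E A = ⨆ T : {T // Adm A T}, ENNReal.ofReal (∫ x in E, vdiv T.1 x) := by
  unfold perimeterIn Adm
  simp only [iSup_subtype, iSup_and]

lemma le_perimeterIn {n : ℕ} {E A : Set (Euc n)} {T : Euc n → Euc n} (h : Adm A T) :
    ENNReal.ofReal (∫ x in E, vdiv T x) ≤ perimeterIn E A := by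
  rw [perimeterIn_eq]
  exact le_iSup (fun T : {T // Adm A T} => ENNReal.ofReal (∫ x in E, vdiv T.1 x)) ⟨T, h⟩

lemma adm_zero {n : ℕ} (A : Set (Euc n)) : Adm A (fun _ => (0 : Euc n)) := by
  refine ⟨contDiff_const, HasCompactSupport.zero, ?_, by simp⟩
  have : tsupport (fun _ : Euc n => (0 : Euc n)) = ∅ := by
    rw [tsupport_eq_empty_iff]; rfl
  simp [this]

lemma vdiv_zero {n : ℕ} (x : Euc n) : vdiv (fun _ : Euc n => (0 : Euc n)) x = 0 := by
  simp [vdiv]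

lemma perimeterIn_add_le {n : ℕ} {E F A B : Set (Euc n)} {C : ℝ≥0∞}
    (h : ∀ T S, Adm A T → Adm B S →
      ENNReal.ofReal ((∫ x in E, vdiv T x) + ∫ x in F, vdiv S x) ≤ C) :
    perimeterIn E A + perimeterIn F B ≤ C := by
  rw [perimeterIn_eq, perimeterIn_eq]
  have : Nonempty {T // Adm A T} := ⟨⟨_, adm_zero A⟩⟩
  have : Nonempty {T // Adm B T} := ⟨⟨_, adm_zero B⟩⟩
  refine ENNReal.iSup_add_iSup_le ?_
  rintro ⟨T, hT⟩ ⟨S, hS⟩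
  dsimp only
  rcases le_total (∫ x in E, vdiv T x) 0 with h1 | h1
  · rw [ENNReal.ofReal_of_nonpos h1, zero_add]
    have := h _ S (adm_zero A) hS
    simpa [vdiv_zero] using this
  rcases le_total (∫ x in F, vdiv S x) 0 with h2 | h2
  · rw [ENNReal.ofReal_of_nonpos h2, add_zero]
    have := h T _ hT (adm_zero B)
    simpa [vdiv_zero] using this
  rw [← ENNReal.ofReal_add h1 h2]
  exact h T S hT hS

lemma perimeter_congr {n : ℕ} {E F : Set (Euc n)} (h : E =ᵐ[volume] F) :
    perimeter E = perimeter F := by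
  unfold perimeter
  rw [perimeterIn_eq, perimeterIn_eq]
  congr 1; ext T
  rw [setIntegral_congr_set h]

/-! ### divergence calculus -/

lemma vdiv_add {n : ℕ} {T S : Euc n → Euc n} (hT : ContDiff ℝ (⊤ : ℕ∞) T)
    (hS : ContDiff ℝ (⊤ : ℕ∞) S) (x : Euc n) :
    vdiv (fun y => T y + S y) x = vdiv T x + vdiv S x := by
  have h1 : DifferentiableAt ℝ T x := (hT.differentiable (by simp)) x
  have h2 : DifferentiableAt ℝ S x := (hS.differentiable (by simp)) x
  unfold vdiv
  rw [fderiv_fun_add h1 h2, ← Finset.sum_add_distrib]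
  simp [inner_add_left]

lemma vdiv_smul {n : ℕ} {f : Euc n → ℝ} {T : Euc n → Euc n} (hf : ContDiff ℝ (⊤ : ℕ∞) f)
    (hT : ContDiff ℝ (⊤ : ℕ∞) T) (x : Euc n) :
    vdiv (fun y => f y • T y) x = f x * vdiv T x + fderiv ℝ f x (T x) := by
  have h1 : DifferentiableAt ℝ T x := (hT.differentiable (by simp)) x
  have h2 : DifferentiableAt ℝ f x := (hf.differentiable (by simp)) x
  have h3 : fderiv ℝ f x (T x) = ∑ i : Fin n,
      fderiv ℝ f x (EuclideanSpace.single i 1) * T x i := by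
    conv_lhs => rw [← (EuclideanSpace.basisFun (Fin n) ℝ).sum_repr (T x)]
    simp [mul_comm]
  rw [h3]
  unfold vdiv
  rw [fderiv_fun_smul h2 h1, Finset.mul_sum, ← Finset.sum_add_distrib]
  refine Finset.sum_congr rfl fun i _ => ?_
  simp [inner_add_left, inner_smul_left, EuclideanSpace.inner_single_right]

lemma continuous_vdiv {n : ℕ} {T : Euc n → Euc n} (hT : ContDiff ℝ (⊤ : ℕ∞) T) :
    Continuous (vdiv T) := by
  have : Continuous (fderiv ℝ T) := hT.continuous_fderiv (by simp)
  unfold vdiv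
  fun_prop

lemma vdiv_eq_zero {n : ℕ} {T : Euc n → Euc n} {x : Euc n} (hx : x ∉ tsupport T) :
    vdiv T x = 0 := by
  have : fderiv ℝ T x = 0 := by
    by_contra h
    exact hx (support_fderiv_subset ℝ h)
  simp [vdiv, this]

lemma compact_vdiv {n : ℕ} {T : Euc n → Euc n} (hT : HasCompactSupport T) :
    HasCompactSupport (vdiv T) :=
  HasCompactSupport.intro hT fun _ hx => vdiv_eq_zero hx

lemma integrable_vdiv {n : ℕ} {T : Euc n → Euc n} (hT : ContDiff ℝ (⊤ : ℕ∞) T)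
    (hc : HasCompactSupport T) : Integrable (vdiv T) :=
  (continuous_vdiv hT).integrable_of_hasCompactSupport (compact_vdiv hc)

lemma integral_vdiv {n : ℕ} {T : Euc n → Euc n} (hT : ContDiff ℝ (⊤ : ℕ∞) T)
    (hc : HasCompactSupport T) : ∫ x, vdiv T x = 0 := by
  have hcf : Continuous (fderiv ℝ T) := hT.continuous_fderiv (by simp)
  have hcf' := hc.fderiv ℝ
  have hI : ∀ i : Fin n, Integrable (fun x => fderiv ℝ T x (EuclideanSpace.single i 1)) := by
    intro i
    refine Continuous.integrable_of_hasCompactSupport (by fun_prop) ?_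
    exact hcf'.comp_left (g := fun L : Euc n →L[ℝ] Euc n => L (EuclideanSpace.single i 1)) rfl
  unfold vdiv
  rw [integral_finsetSum]
  · refine Finset.sum_eq_zero fun i _ => ?_
    have := integral_smul_fderiv_eq_neg_fderiv_smul_of_integrable (μ := (volume : Measure (Euc n)))
      (f := fun _ : Euc n => (1 : ℝ)) (g := T) (v := EuclideanSpace.single i 1)
      (by simp) (by simpa using hI i)
      (by simpa using hT.continuous.integrable_of_hasCompactSupport hc)
      (by fun_prop) (fun x _ => (hT.differentiable (by simp)) x)
    have h0 : ∫ x, fderiv ℝ T x (EuclideanSpace.single i 1) = 0 := by simpa using this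
    simp only [real_inner_comm (EuclideanSpace.single i (1 : ℝ))]
    rw [integral_inner (hI i), h0, inner_zero_right]
  · intro i _
    exact (hI i).inner_const _

/-! ### mollification -/

/-- Mollified characteristic function. -/
def moll {n : ℕ} (φ : ContDiffBump (0 : Euc n)) (E : Set (Euc n)) : Euc n → ℝ :=
  convolution (φ.normed volume) (E.indicator (fun _ => (1 : ℝ))) (ContinuousLinearMap.lsmul ℝ ℝ)
    volume

lemma moll_apply {n : ℕ} (φ : ContDiffBump (0 : Euc n)) (E : Set (Euc n)) (x : Euc n) :
    moll φ E x = ∫ t, φ.normed volume t * E.indicator (fun _ => (1 : ℝ)) (x - t) := by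
  simp [moll, convolution]

lemma locInt_ind {n : ℕ} {E : Set (Euc n)} (hE : MeasurableSet E) :
    LocallyIntegrable (E.indicator (fun _ => (1 : ℝ))) (volume : Measure (Euc n)) :=
  (locallyIntegrable_const (1 : ℝ)).indicator hE

lemma moll_contDiff {n : ℕ} (φ : ContDiffBump (0 : Euc n)) {E : Set (Euc n)}
    (hE : MeasurableSet E) : ContDiff ℝ (⊤ : ℕ∞) (moll φ E) :=
  HasCompactSupport.contDiff_convolution_left _ φ.hasCompactSupport_normed φ.contDiff_normed
    (locInt_ind hE)

lemma moll_nonneg {n : ℕ} (φ : ContDiffBump (0 : Euc n)) (E : Set (Euc n)) (x : Euc n) :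
    0 ≤ moll φ E x := by
  rw [moll_apply]
  exact integral_nonneg fun t => mul_nonneg (φ.nonneg_normed t)
    (indicator_nonneg (fun _ _ => zero_le_one) _)

lemma moll_le_one {n : ℕ} (φ : ContDiffBump (0 : Euc n)) (E : Set (Euc n)) (x : Euc n) :
    moll φ E x ≤ 1 := by
  rw [moll_apply]
  refine le_trans ?_ (φ.integral_normed (μ := (volume : Measure (Euc n)))).le
  refine integral_mono_of_nonneg (ae_of_all _ fun t => mul_nonneg (φ.nonneg_normed t)
    (indicator_nonneg (fun _ _ => zero_le_one) _)) φ.integrable_normed (ae_of_all _ fun t => ?_)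
  refine mul_le_of_le_one_right (φ.nonneg_normed t) ?_
  exact indicator_le_self' (fun _ _ => zero_le_one) _

lemma vdiv_translate {n : ℕ} (X : Euc n → Euc n) (t x : Euc n) :
    vdiv (fun y => X (y + t)) x = vdiv X (x + t) := by
  simp [vdiv, fderiv_comp_add_right]

lemma adm_translate {n : ℕ} {X : Euc n → Euc n} (h : Adm univ X) (t : Euc n) :
    Adm univ (fun y => X (y + t)) := by
  obtain ⟨h1, h2, _, h4⟩ := h
  refine ⟨h1.comp (contDiff_id.add contDiff_const), ?_, subset_univ _, fun x => h4 _⟩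
  exact h2.comp_homeomorph (Homeomorph.addRight t)

lemma moll_vdiv_le {n : ℕ} (φ : ContDiffBump (0 : Euc n)) {E : Set (Euc n)}
    (hE : MeasurableSet E) {X : Euc n → Euc n} (hX : Adm univ X) :
    ENNReal.ofReal (∫ x, moll φ E x * vdiv X x) ≤ perimeter E := by
  by_cases hP : perimeter E = ⊤
  · rw [hP]; exact le_top
  set P := (perimeter E).toReal with hPdef
  have hb : ∀ t, ∫ x in E, vdiv X (x + t) ≤ P := by
    intro t
    have := le_perimeterIn (E := E) (adm_translate hX t)
    simp only [vdiv_translate] at this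
    exact (ENNReal.ofReal_le_iff_le_toReal hP).1 this
  have hinner : ∀ t, ∫ x, E.indicator (fun _ => (1 : ℝ)) (x - t) * vdiv X x
      = ∫ x in E, vdiv X (x + t) := by
    intro t
    rw [← integral_indicator hE,
      ← integral_add_right_eq_self (fun x => E.indicator (fun _ => (1 : ℝ)) (x - t) * vdiv X x) t]
    congr 1; ext x
    by_cases hx : x ∈ E <;> simp [hx]
  have hInt : Integrable (fun p : Euc n × Euc n =>
      (φ.normed volume p.2 * E.indicator (fun _ => (1 : ℝ)) (p.1 - p.2)) * vdiv X p.1)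
      (volume.prod volume) := by
    have h0 := (integrable_vdiv hX.1 hX.2.1).mul_prod
      (φ.integrable_normed (μ := (volume : Measure (Euc n))))
    have hm : Measurable (fun p : Euc n × Euc n => E.indicator (fun _ => (1 : ℝ)) (p.1 - p.2)) :=
      (measurable_const.indicator hE).comp (measurable_fst.sub measurable_snd)
    have := h0.bdd_mul (c := 1) hm.aestronglyMeasurable (ae_of_all _ fun p => by
      by_cases hx : p.1 - p.2 ∈ E <;> simp [hx])
    refine this.congr (ae_of_all _ fun p => ?_)
    dsimp only; ring
  have key : ∫ x, moll φ E x * vdiv X x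
      = ∫ t, φ.normed volume t * ∫ x in E, vdiv X (x + t) := by
    simp only [moll_apply, ← integral_mul_const]
    rw [integral_integral_swap hInt]
    congr 1; ext t
    rw [← hinner t, ← integral_const_mul]
    congr 1; ext x; ring
  rw [key]
  refine (ENNReal.ofReal_le_iff_le_toReal hP).2 ?_
  have hP0 : 0 ≤ P := ENNReal.toReal_nonneg
  have hle : ∀ t, φ.normed volume t * ∫ x in E, vdiv X (x + t) ≤ φ.normed volume t * P :=
    fun t => mul_le_mul_of_nonneg_left (hb t) (φ.nonneg_normed t)
  by_cases hi : Integrable (fun t => φ.normed volume t * ∫ x in E, vdiv X (x + t))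
  · calc _ ≤ ∫ t, φ.normed volume t * P :=
          integral_mono hi (φ.integrable_normed.mul_const P) hle
      _ = P := by rw [integral_mul_const, φ.integral_normed, one_mul]
  · rw [integral_undef hi]; exact hP0

lemma adm_comb {n : ℕ} {T S : Euc n → Euc n} (hT : Adm univ T) (hS : Adm univ S)
    {v : Euc n → ℝ} (hv : ContDiff ℝ (⊤ : ℕ∞) v) (h0 : ∀ x, 0 ≤ v x) (h1 : ∀ x, v x ≤ 1) :
    Adm univ (fun x => v x • T x + (1 - v x) • S x) := by
  refine ⟨(hv.smul hT.1).add ((contDiff_const.sub hv).smul hS.1), ?_, subset_univ _, fun x => ?_⟩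
  · exact (hT.2.1.smul_left (f := v)).add (hS.2.1.smul_left (f := fun x => 1 - v x))
  · refine (norm_add_le _ _).trans ?_
    rw [norm_smul, norm_smul, Real.norm_of_nonneg (h0 x),
      Real.norm_of_nonneg (sub_nonneg.2 (h1 x))]
    nlinarith [hT.2.2.2 x, hS.2.2.2 x, h0 x, h1 x]

lemma vdiv_comb {n : ℕ} {T S : Euc n → Euc n} (hT : Adm univ T) (hS : Adm univ S)
    {v : Euc n → ℝ} (hv : ContDiff ℝ (⊤ : ℕ∞) v) (x : Euc n) :
    vdiv (fun x => v x • T x + (1 - v x) • S x) x =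
      v x * vdiv T x + (1 - v x) * vdiv S x + fderiv ℝ v x (T x) - fderiv ℝ v x (S x) := by
  have hw : ContDiff ℝ (⊤ : ℕ∞) (fun x => 1 - v x) := contDiff_const.sub hv
  have a1 : ContDiff ℝ (⊤ : ℕ∞) (fun x => v x • T x) := hv.smul hT.1
  have a2 : ContDiff ℝ (⊤ : ℕ∞) (fun x => (1 - v x) • S x) := hw.smul hS.1
  rw [vdiv_add a1 a2, vdiv_smul hv hT.1, vdiv_smul hw hS.1,
    fderiv_const_sub]
  simp only [ContinuousLinearMap.neg_apply]
  ring

lemma smooth_identity {n : ℕ} {T S : Euc n → Euc n} (hT : Adm univ T) (hS : Adm univ S)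
    {u v : Euc n → ℝ} (hu : ContDiff ℝ (⊤ : ℕ∞) u) (hv : ContDiff ℝ (⊤ : ℕ∞) v) :
    (∫ x, (u x + v x - u x * v x) * vdiv T x + (u x * v x) * vdiv S x)
      = (∫ x, u x * vdiv (fun x => v x • S x + (1 - v x) • T x) x)
        + ∫ x, v x * vdiv (fun x => u x • S x + (1 - u x) • T x) x := by
  have huv : ContDiff ℝ (⊤ : ℕ∞) (fun x => u x * v x) := hu.mul hv
  have hcS : HasCompactSupport (fun x => (u x * v x) • S x) :=
    hS.2.1.smul_left (f := fun x => u x * v x)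
  have hcT : HasCompactSupport (fun x => (u x * v x) • T x) :=
    hT.2.1.smul_left (f := fun x => u x * v x)
  have sS : ContDiff ℝ (⊤ : ℕ∞) (fun x => (u x * v x) • S x) := huv.smul hS.1
  have sT : ContDiff ℝ (⊤ : ℕ∞) (fun x => (u x * v x) • T x) := huv.smul hT.1
  have iS := integrable_vdiv sS hcS
  have iT := integrable_vdiv sT hcT
  have zS := integral_vdiv sS hcS
  have zT := integral_vdiv sT hcT
  have mk : ∀ {f g : Euc n → ℝ}, ContDiff ℝ (⊤ : ℕ∞) f → Continuous g → HasCompactSupport g →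
      Integrable (fun x => f x * g x) := fun hf hg hc =>
    (hf.continuous.mul hg).integrable_of_hasCompactSupport hc.mul_left
  have cX : ∀ {w : Euc n → ℝ}, ContDiff ℝ (⊤ : ℕ∞) w →
      ContDiff ℝ (⊤ : ℕ∞) (fun x => w x • S x + (1 - w x) • T x) ∧
      HasCompactSupport (fun x => w x • S x + (1 - w x) • T x) := fun {w} hw =>
    ⟨(hw.smul hS.1).add ((contDiff_const.sub hw).smul hT.1),
     (hS.2.1.smul_left (f := w)).add (hT.2.1.smul_left (f := fun x => 1 - w x))⟩
  have i1 := mk hu (continuous_vdiv (cX hv).1) (compact_vdiv (cX hv).2)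
  have i2 := mk hv (continuous_vdiv (cX hu).1) (compact_vdiv (cX hu).2)
  have i3 := mk ((hu.add hv).sub huv) (continuous_vdiv hT.1) (compact_vdiv hT.2.1)
  have i4 := mk huv (continuous_vdiv hS.1) (compact_vdiv hS.2.1)
  have iL : Integrable (fun x => (u x + v x - u x * v x) * vdiv T x
      + (u x * v x) * vdiv S x) := i3.add i4
  have e : (∫ x, u x * vdiv (fun x => v x • S x + (1 - v x) • T x) x)
        + ∫ x, v x * vdiv (fun x => u x • S x + (1 - u x) • T x) x
      = (∫ x, (u x + v x - u x * v x) * vdiv T x + (u x * v x) * vdiv S x)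
        + ((∫ x, vdiv (fun x => (u x * v x) • S x) x)
          - ∫ x, vdiv (fun x => (u x * v x) • T x) x) := by
    have iD : Integrable (fun x => vdiv (fun x => (u x * v x) • S x) x
        - vdiv (fun x => (u x * v x) • T x) x) := iS.sub iT
    rw [← integral_add i1 i2, ← integral_sub iS iT, ← integral_add iL iD]
    congr 1; ext x
    have d1 : DifferentiableAt ℝ u x := (hu.differentiable (by simp)) x
    have d2 : DifferentiableAt ℝ v x := (hv.differentiable (by simp)) x
    rw [vdiv_comb hS hT hv, vdiv_comb hS hT hu, vdiv_smul huv hS.1, vdiv_smul huv hT.1,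
      fderiv_fun_mul d1 d2]
    simp only [ContinuousLinearMap.add_apply, ContinuousLinearMap.smul_apply, smul_eq_mul]
    ring
  rw [e, zS, zT]; ring

/-- A shrinking sequence of bumps. -/
def bump (n : ℕ) (k : ℕ) : ContDiffBump (0 : Euc n) where
  rIn := 1 / ((k : ℝ) + 1)
  rOut := 2 * (1 / ((k : ℝ) + 1))
  rIn_pos := by positivity
  rIn_lt_rOut := by
    have : (0 : ℝ) < 1 / ((k : ℝ) + 1) := by positivity
    linarith

lemma moll_tendsto {n : ℕ} {E : Set (Euc n)} (hE : MeasurableSet E) :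
    ∀ᵐ x, Tendsto (fun k => moll (bump n k) E x) atTop
      (𝓝 (E.indicator (fun _ => (1 : ℝ)) x)) := by
  refine ContDiffBump.ae_convolution_tendsto_right_of_locallyIntegrable (K := 2) ?_ ?_
    (locInt_ind hE)
  · have := (tendsto_one_div_add_atTop_nhds_zero_nat (𝕜 := ℝ)).const_mul 2
    simpa [bump] using this
  · exact Eventually.of_forall fun k => le_refl _

/-- Strong subadditivity of the perimeter. -/
lemma perimeter_union_add_inter {n : ℕ} {E F : Set (Euc n)} (hE : MeasurableSet E)
    (hF : MeasurableSet F) :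
    perimeter (E ∪ F) + perimeter (E ∩ F) ≤ perimeter E + perimeter F := by
  refine perimeterIn_add_le fun T S hT hS => ?_
  have iT := integrable_vdiv hT.1 hT.2.1
  have iS := integrable_vdiv hS.1 hS.2.1
  set u : ℕ → Euc n → ℝ := fun k => moll (bump n k) E
  set v : ℕ → Euc n → ℝ := fun k => moll (bump n k) F
  have hu : ∀ k, ContDiff ℝ (⊤ : ℕ∞) (u k) := fun k => moll_contDiff _ hE
  have hv : ∀ k, ContDiff ℝ (⊤ : ℕ∞) (v k) := fun k => moll_contDiff _ hF
  have u0 : ∀ k x, 0 ≤ u k x := fun k x => moll_nonneg _ _ _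
  have v0 : ∀ k x, 0 ≤ v k x := fun k x => moll_nonneg _ _ _
  have u1 : ∀ k x, u k x ≤ 1 := fun k x => moll_le_one _ _ _
  have v1 : ∀ k x, v k x ≤ 1 := fun k x => moll_le_one _ _ _
  have lim : Tendsto (fun k => ∫ x, (u k x + v k x - u k x * v k x) * vdiv T x
      + (u k x * v k x) * vdiv S x) atTop
      (𝓝 (∫ x, (E ∪ F).indicator (vdiv T) x + (E ∩ F).indicator (vdiv S) x)) := by
    refine tendsto_integral_of_dominated_convergence (fun x => ‖vdiv T x‖ + ‖vdiv S x‖)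
      (fun k => ?_) (iT.norm.add iS.norm) (fun k => ae_of_all _ fun x => ?_) ?_
    · have := (hu k).continuous
      have := (hv k).continuous
      have := continuous_vdiv hT.1
      have := continuous_vdiv hS.1
      exact Continuous.aestronglyMeasurable (by fun_prop)
    · refine (norm_add_le _ _).trans (add_le_add ?_ ?_)
      · rw [norm_mul]
        refine mul_le_of_le_one_left (norm_nonneg _) ?_
        rw [Real.norm_eq_abs, abs_le]
        constructor <;> nlinarith [u0 k x, v0 k x, u1 k x, v1 k x,
          mul_nonneg (u0 k x) (v0 k x), mul_nonneg (sub_nonneg.2 (u1 k x)) (sub_nonneg.2 (v1 k x))]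
      · rw [norm_mul]
        refine mul_le_of_le_one_left (norm_nonneg _) ?_
        rw [Real.norm_eq_abs, abs_of_nonneg (mul_nonneg (u0 k x) (v0 k x))]
        exact mul_le_one₀ (u1 k x) (v0 k x) (v1 k x)
    · filter_upwards [moll_tendsto hE, moll_tendsto hF] with x h1 h2
      have := (((h1.add h2).sub (h1.mul h2)).mul_const (vdiv T x)).add
        ((h1.mul h2).mul_const (vdiv S x))
      convert this using 2
      by_cases a : x ∈ E <;> by_cases b : x ∈ F <;> simp [a, b]
  have hEF : (∫ x in E ∪ F, vdiv T x) + ∫ x in E ∩ F, vdiv S x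
      = ∫ x, (E ∪ F).indicator (vdiv T) x + (E ∩ F).indicator (vdiv S) x := by
    rw [integral_add (iT.indicator (hE.union hF)) (iS.indicator (hE.inter hF)),
      integral_indicator (hE.union hF), integral_indicator (hE.inter hF)]
  rw [hEF]
  refine le_of_tendsto ((ENNReal.continuous_ofReal.tendsto _).comp lim)
    (Eventually.of_forall fun k => ?_)
  simp only [Function.comp]
  rw [smooth_identity hT hS (hu k) (hv k)]
  exact ENNReal.ofReal_add_le.trans (add_le_add
    (moll_vdiv_le _ hE (adm_comb hS hT (hv k) (v0 k) (v1 k)))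
    (moll_vdiv_le _ hF (adm_comb hS hT (hu k) (u0 k) (u1 k))))

/-- Localisation. -/
lemma perimeter_localize {n : ℕ} {M L A : Set (Euc n)} (hM : MeasurableSet M)
    (hL : MeasurableSet L) (hLM : L ⊆ M) (hA : IsOpen A) (hb : IsBounded A)
    (hK : closure (M \ L) ⊆ A) :
    perimeterIn M A + perimeter L ≤ perimeter M + perimeterIn L A := by
  refine perimeterIn_add_le fun T S hT hS => ?_
  set K := closure (M \ L) ∪ tsupport T with hKdef
  have hKc : IsCompact K :=
    (Metric.isCompact_of_isClosed_isBounded isClosed_closure (hb.subset hK)).union hT.2.1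
  have hKA : K ⊆ A := union_subset hK hT.2.2.1
  obtain ⟨φ, hφ0, hφ1, hφr⟩ := exists_contMDiffMap_zero_one_nhds_of_isClosed
    (modelWithCornersSelf ℝ (Euc n)) (n := ⊤)
    (s := Aᶜ) (t := K) hA.isClosed_compl hKc.isClosed
    (disjoint_compl_left_iff_subset.2 hKA)
  have hφ : ContDiff ℝ (⊤ : ℕ∞) (fun x => φ x) := φ.contMDiff.contDiff
  have hψ : ContDiff ℝ (⊤ : ℕ∞) (fun x => 1 - φ x) := contDiff_const.sub hφ
  have hψS : ContDiff ℝ (⊤ : ℕ∞) (fun x => (1 - φ x) • S x) := hψ.smul hS.1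
  have hφS : ContDiff ℝ (⊤ : ℕ∞) (fun x => φ x • S x) := hφ.smul hS.1
  have cψS : HasCompactSupport (fun x => (1 - φ x) • S x) :=
    hS.2.1.smul_left (f := fun x => 1 - φ x)
  have cφS : HasCompactSupport (fun x => φ x • S x) := hS.2.1.smul_left (f := fun x => φ x)
  have hV : Adm univ (fun x => T x + (1 - φ x) • S x) := by
    refine ⟨hT.1.add hψS, hT.2.1.add cψS, subset_univ _, fun x => ?_⟩
    by_cases hx : x ∈ tsupport T
    · have : φ x = 1 := hφ1.self_of_nhdsSet x (Or.inr hx)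
      simpa [this] using hT.2.2.2 x
    · dsimp only
      rw [image_eq_zero_of_notMem_tsupport hx, zero_add, norm_smul,
        Real.norm_of_nonneg (sub_nonneg.2 (hφr x).2)]
      have := (hφr x).1
      have := (hφr x).2
      have := hS.2.2.2 x
      have := norm_nonneg (S x)
      nlinarith
  have hW : Adm A (fun x => φ x • S x) := by
    refine ⟨hφS, cφS, fun x hx => ?_, fun x => ?_⟩
    · by_contra hxA
      refine (notMem_tsupport_iff_eventuallyEq.2 ?_) hx
      filter_upwards [eventually_nhdsSet_iff_forall.1 hφ0 x hxA] with y hy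
      simp [hy]
    · rw [norm_smul, Real.norm_of_nonneg (hφr x).1]
      exact mul_le_one₀ (hφr x).2 (norm_nonneg _) (hS.2.2.2 x)
  have hzero : ∀ x ∈ M \ L, vdiv (fun x => (1 - φ x) • S x) x = 0 := by
    intro x hx
    refine vdiv_eq_zero (notMem_tsupport_iff_eventuallyEq.2 ?_)
    filter_upwards [eventually_nhdsSet_iff_forall.1 hφ1 x (Or.inl (subset_closure hx))] with y hy
    simp [hy]
  have iT := integrable_vdiv hT.1 hT.2.1
  have iψ := integrable_vdiv hψS cψS
  have iφ := integrable_vdiv hφS cφS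
  have e1 : ∫ x in M, vdiv (fun x => T x + (1 - φ x) • S x) x
      = (∫ x in M, vdiv T x) + ∫ x in M, vdiv (fun x => (1 - φ x) • S x) x := by
    simp only [vdiv_add hT.1 hψS]
    exact integral_add iT.integrableOn iψ.integrableOn
  have e2 : ∫ x in M, vdiv (fun x => (1 - φ x) • S x) x
      = ∫ x in L, vdiv (fun x => (1 - φ x) • S x) x :=
    setIntegral_eq_of_subset_of_forall_diff_eq_zero hM hLM hzero
  have e3 : ∫ x in L, vdiv S x = (∫ x in L, vdiv (fun x => (1 - φ x) • S x) x)
      + ∫ x in L, vdiv (fun x => φ x • S x) x := by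
    rw [← integral_add iψ.integrableOn iφ.integrableOn]
    congr 1; ext x
    rw [← vdiv_add hψS hφS]
    congr 1; ext1 y
    rw [← add_smul]; simp
  have e : (∫ x in M, vdiv T x) + ∫ x in L, vdiv S x
      = (∫ x in M, vdiv (fun x => T x + (1 - φ x) • S x) x)
        + ∫ x in L, vdiv (fun x => φ x • S x) x := by
    rw [e1, e2, e3]; ring
  rw [e]
  exact ENNReal.ofReal_add_le.trans (add_le_add (le_perimeterIn hV) (le_perimeterIn hW))

lemma perimeter_inter_lt_top {n : ℕ} {E F : Set (Euc n)} (hE : MeasurableSet E)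
    (hF : MeasurableSet F) (h1 : perimeter E < ⊤) (h2 : perimeter F < ⊤) :
    perimeter (E ∩ F) < ⊤ :=
  lt_of_le_of_lt (le_add_self.trans (perimeter_union_add_inter hE hF))
    (ENNReal.add_lt_top.2 ⟨h1, h2⟩)

lemma perimeter_biUnion {n N : ℕ} {Ω : Set (Euc n)} (𝓔 : NCluster n N Ω) {L : Set (Euc n)}
    (hL : MeasurableSet L) (J : Finset (Fin N)) :
    perimeter (L ∪ ⋃ j ∈ J, 𝓔.cham j) + ∑ j ∈ J, perimeter (𝓔.cham j ∩ L)
      ≤ perimeter L + ∑ j ∈ J, perimeter (𝓔.cham j) := by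
  induction J using Finset.induction_on with
  | empty => simp
  | insert k J hk ih =>
    have hU : MeasurableSet (⋃ j ∈ J, 𝓔.cham j) :=
      J.measurableSet_biUnion fun j _ => 𝓔.measurableSet_cham j
    have hs := perimeter_union_add_inter (hL.union hU) (𝓔.measurableSet_cham k)
    have h1 : (L ∪ ⋃ j ∈ J, 𝓔.cham j) ∪ 𝓔.cham k = L ∪ ⋃ j ∈ insert k J, 𝓔.cham j := by
      rw [Finset.set_biUnion_insert, union_assoc, union_comm (𝓔.cham k)]
    have h2 : perimeter ((L ∪ ⋃ j ∈ J, 𝓔.cham j) ∩ 𝓔.cham k) = perimeter (𝓔.cham k ∩ L) := by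
      apply perimeter_congr
      have hz : volume ((⋃ j ∈ J, 𝓔.cham j) ∩ 𝓔.cham k) = 0 := by
        rw [iUnion₂_inter]
        refine (measure_biUnion_null_iff J.countable_toSet).2 fun j hj => 𝓔.ae_disjoint j k ?_
        rintro rfl; exact hk hj
      rw [union_inter_distrib_right, inter_comm L]
      exact union_ae_eq_left_of_ae_eq_empty (ae_eq_empty.2 hz)
    rw [h1, h2] at hs
    rw [Finset.sum_insert hk, Finset.sum_insert hk]
    calc _ = (perimeter (L ∪ ⋃ j ∈ insert k J, 𝓔.cham j) + perimeter (𝓔.cham k ∩ L))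
          + ∑ j ∈ J, perimeter (𝓔.cham j ∩ L) := by ring
      _ ≤ (perimeter (L ∪ ⋃ j ∈ J, 𝓔.cham j) + perimeter (𝓔.cham k))
          + ∑ j ∈ J, perimeter (𝓔.cham j ∩ L) := by gcongr
      _ = (perimeter (L ∪ ⋃ j ∈ J, 𝓔.cham j) + ∑ j ∈ J, perimeter (𝓔.cham j ∩ L))
          + perimeter (𝓔.cham k) := by ring
      _ ≤ (perimeter L + ∑ j ∈ J, perimeter (𝓔.cham j)) + perimeter (𝓔.cham k) := by gcongr
      _ = _ := by ring

/-- Shrinking one chamber. -/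
def shrink {n N : ℕ} {Ω : Set (Euc n)} (𝓔 : NCluster n N Ω) (k : Fin N) (F : Set (Euc n))
    (hF : MeasurableSet F) (hsub : F ⊆ 𝓔.cham k) (hpos : 0 < volume F)
    (hP : perimeter F < ⊤) : NCluster n N Ω where
  cham := Function.update 𝓔.cham k F
  measurableSet_cham j := by
    by_cases h : j = k
    · subst h; simpa using hF
    · simpa [h] using 𝓔.measurableSet_cham j
  cham_subset j := by
    by_cases h : j = k
    · subst h; simpa using hsub.trans (𝓔.cham_subset j)
    · simpa [h] using 𝓔.cham_subset j
  vol_pos j := by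
    by_cases h : j = k
    · subst h; simpa using hpos
    · simpa [h] using 𝓔.vol_pos j
  vol_lt_top j := by
    by_cases h : j = k
    · subst h; simpa using (measure_mono hsub).trans_lt (𝓔.vol_lt_top j)
    · simpa [h] using 𝓔.vol_lt_top j
  perimeter_lt_top j := by
    by_cases h : j = k
    · subst h; simpa using hP
    · simpa [h] using 𝓔.perimeter_lt_top j
  ae_disjoint a b hab := by
    have hle : ∀ j, Function.update 𝓔.cham k F j ⊆ 𝓔.cham j := by
      intro j
      by_cases h : j = k
      · subst h; simpa using hsub
      · simp [h]
    exact measure_mono_null (inter_subset_inter (hle a) (hle b)) (𝓔.ae_disjoint a b hab)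

lemma ratio_lt_top {n N : ℕ} {Ω : Set (Euc n)} (𝓔 : NCluster n N Ω) (k : Fin N) :
    perimeter (𝓔.cham k) / volume (𝓔.cham k) < ⊤ :=
  ENNReal.div_lt_top (𝓔.perimeter_lt_top k).ne (𝓔.vol_pos k).ne'

lemma ratio_le {n N : ℕ} {Ω : Set (Euc n)} {𝓔 : NCluster n N Ω} (h𝓔 : IsCheegerNCluster 𝓔)
    (k : Fin N) (F : Set (Euc n)) (hF : MeasurableSet F) (hsub : F ⊆ 𝓔.cham k)
    (hpos : 0 < volume F) (hP : perimeter F < ⊤) :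
    perimeter (𝓔.cham k) / volume (𝓔.cham k) ≤ perimeter F / volume F := by
  have h : clusterEnergy 𝓔 ≤ clusterEnergy (shrink 𝓔 k F hF hsub hpos hP) := by
    rw [h𝓔]; exact iInf_le _ _
  unfold clusterEnergy at h
  rw [← Finset.add_sum_erase _ _ (Finset.mem_univ k),
    ← Finset.add_sum_erase _ _ (Finset.mem_univ k)] at h
  have e : ∑ j ∈ Finset.univ.erase k, perimeter ((shrink 𝓔 k F hF hsub hpos hP).cham j)
      / volume ((shrink 𝓔 k F hF hsub hpos hP).cham j)
      = ∑ j ∈ Finset.univ.erase k, perimeter (𝓔.cham j) / volume (𝓔.cham j) := by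
    refine Finset.sum_congr rfl fun j hj => ?_
    simp [shrink, Finset.ne_of_mem_erase hj]
  rw [e] at h
  have h' := (ENNReal.add_le_add_iff_right
    (ENNReal.sum_lt_top.2 fun j _ => ratio_lt_top 𝓔 j).ne).1 h
  simpa [shrink] using h'

lemma chamber_le {n N : ℕ} {Ω : Set (Euc n)} {𝓔 : NCluster n N Ω} (h𝓔 : IsCheegerNCluster 𝓔)
    (k : Fin N) {L : Set (Euc n)} (hL : MeasurableSet L) (hP : perimeter L < ⊤) :
    perimeter (𝓔.cham k) ≤ perimeter (𝓔.cham k ∩ L)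
      + NCheeger n N Ω * volume (𝓔.cham k \ L) := by
  set h := perimeter (𝓔.cham k) / volume (𝓔.cham k) with hdef
  have hH : h ≤ NCheeger n N Ω := by
    rw [← h𝓔]
    exact Finset.single_le_sum (f := fun j => perimeter (𝓔.cham j) / volume (𝓔.cham j))
      (fun _ _ => zero_le) (Finset.mem_univ k)
  have e : perimeter (𝓔.cham k) = h * volume (𝓔.cham k) :=
    (ENNReal.div_mul_cancel (𝓔.vol_pos k).ne' (𝓔.vol_lt_top k).ne).symm
  have h1 : h * volume (𝓔.cham k ∩ L) ≤ perimeter (𝓔.cham k ∩ L) := by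
    rcases eq_or_ne (volume (𝓔.cham k ∩ L)) 0 with h0 | h0
    · simp [h0]
    have := ratio_le h𝓔 k (𝓔.cham k ∩ L) ((𝓔.measurableSet_cham k).inter hL) inter_subset_left
      (pos_iff_ne_zero.2 h0)
      (perimeter_inter_lt_top (𝓔.measurableSet_cham k) hL (𝓔.perimeter_lt_top k) hP)
    exact ENNReal.mul_le_of_le_div this
  rw [e, ← measure_inter_add_diff (𝓔.cham k) hL, mul_add]
  exact add_le_add h1 (by gcongr)

/-- **Step one of Theorem `regolare`**: if `𝓔` is a Cheeger `N`-cluster of an open bounded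
set `Ω` and `Mᵢ = ⋃_{j ≠ i} 𝓔(j)`, then `Mᵢ` has distributional mean curvature at most
`H_N(Ω)` in `Ω` with radius `r₀ = n / (4 H_N(Ω))`: for every ball `B_r(x) ⊂⊂ Ω` with
`r < r₀` and every set of finite perimeter `L ⊆ Mᵢ` with `Mᵢ \ L ⊂⊂ B_r(x)`, one has
`P(Mᵢ; B_r) ≤ P(L; B_r) + H_N(Ω) |Mᵢ \ L|`. -/
theorem union_of_other_chambers_mean_curvature_bound (n N : ℕ) (Ω : Set (Euc n))
    (hΩopen : IsOpen Ω) (hΩbd : IsBounded Ω)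
    (𝓔 : NCluster n N Ω) (h𝓔 : IsCheegerNCluster 𝓔) (i : Fin N) :
    ∀ (x : Euc n) (r : ℝ), 0 < r → closure (ball x r) ⊆ Ω →
      ENNReal.ofReal r < (n : ℝ≥0∞) / (4 * NCheeger n N Ω) →
      ∀ L : Set (Euc n), MeasurableSet L → perimeter L < ⊤ →
        L ⊆ ⋃ j ∈ ({i}ᶜ : Set (Fin N)), 𝓔.cham j →
        closure ((⋃ j ∈ ({i}ᶜ : Set (Fin N)), 𝓔.cham j) \ L) ⊆ ball x r →
        perimeterIn (⋃ j ∈ ({i}ᶜ : Set (Fin N)), 𝓔.cham j) (ball x r)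
          ≤ perimeterIn L (ball x r)
            + NCheeger n N Ω * volume ((⋃ j ∈ ({i}ᶜ : Set (Fin N)), 𝓔.cham j) \ L) := by
  intro x r _ _ _ L hL hLP hLM hK
  set H := NCheeger n N Ω
  set J : Finset (Fin N) := Finset.univ.erase i with hJ
  have hMJ : (⋃ j ∈ ({i}ᶜ : Set (Fin N)), 𝓔.cham j) = ⋃ j ∈ J, 𝓔.cham j := by
    simp [hJ]
  rw [hMJ] at hLM hK ⊢
  set M := ⋃ j ∈ J, 𝓔.cham j with hMdef
  have hM : MeasurableSet M := J.measurableSet_biUnion fun j _ => 𝓔.measurableSet_cham j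
  have hvol : ∑ j ∈ J, volume (𝓔.cham j \ L) = volume (M \ L) := by
    have hd : M \ L = ⋃ j ∈ J, (𝓔.cham j \ L) := by
      ext y
      simp only [hMdef, mem_diff, mem_iUnion, exists_prop]
      constructor
      · rintro ⟨⟨j, hj, hy⟩, hyL⟩
        exact ⟨j, hj, hy, hyL⟩
      · rintro ⟨j, hj, hy, hyL⟩
        exact ⟨⟨j, hj, hy⟩, hyL⟩
    rw [hd, measure_biUnion_finset₀]
    · intro a _ b _ hab
      exact measure_mono_null (inter_subset_inter diff_subset diff_subset) (𝓔.ae_disjoint a b hab)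
    · exact fun j _ => ((𝓔.measurableSet_cham j).diff hL).nullMeasurableSet
  have hsum : ∑ j ∈ J, perimeter (𝓔.cham j ∩ L) ≠ ⊤ :=
    (ENNReal.sum_lt_top.2 fun j _ => perimeter_inter_lt_top (𝓔.measurableSet_cham j) hL
      (𝓔.perimeter_lt_top j) hLP).ne
  have h1 := perimeter_biUnion 𝓔 hL J
  rw [← hMdef, union_eq_self_of_subset_left hLM] at h1
  have h2 : ∑ j ∈ J, perimeter (𝓔.cham j)
      ≤ ∑ j ∈ J, perimeter (𝓔.cham j ∩ L) + H * volume (M \ L) := by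
    rw [← hvol, Finset.mul_sum, ← Finset.sum_add_distrib]
    exact Finset.sum_le_sum fun j _ => chamber_le h𝓔 j hL hLP
  have h3 : perimeter M ≤ perimeter L + H * volume (M \ L) := by
    refine (ENNReal.add_le_add_iff_right hsum).1 (h1.trans ?_)
    calc _ ≤ perimeter L + (∑ j ∈ J, perimeter (𝓔.cham j ∩ L) + H * volume (M \ L)) := by gcongr
      _ = _ := by ring
  have h4 := perimeter_localize hM hL hLM isOpen_ball isBounded_ball hK
  refine (ENNReal.add_le_add_iff_right hLP.ne).1 (h4.trans ?_)
  calc _ ≤ (perimeter L + H * volume (M \ L)) + perimeterIn L (ball x r) := by gcongr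
    _ = _ := by ring

end
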